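/- Let x, y ∈ [0,1] and consider the six points of ℝ³: Q₁ = (1,1,1), Q₂ = (0,0,0), Q₃ = (x,0,0), Q₄ = (0,y,0), Q₅ = (x,1,x), Q₆ = (1,y,y). Then {z ∈ ℝ : (x, y, z) belongs to the convex hull of {Q₁,…,Q₆}} = [x·y, min(x, y)]. (Geometric core of the characterization of coherent assessments on {A|H, A|K, (A|H)∧(A|K)}: the coherent extensions z are exactly those with T_P(x,y) = xy ≤ z ≤ min{x,y} = T_M(x,y).) -/

import Mathlib

/-- The coherent extensions `z` of an assessment `(x,y)` on `{A|H, A|K}` to the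
    conjunction `(A|H)∧(A|K)`: the set of `z` with `(x,y,z)` in the convex hull
    of `Q₁=(1,1,1), Q₂=(0,0,0), Q₃=(x,0,0), Q₄=(0,y,0), Q₅=(x,1,x), Q₆=(1,y,y)`
    equals the interval `[x·y, min(x,y)]`. -/
theorem conjunction_AH_AK_interval (x y : ℝ)
    (hx : x ∈ Set.Icc (0 : ℝ) 1) (hy : y ∈ Set.Icc (0 : ℝ) 1) :
    {z : ℝ | (![x, y, z] : Fin 3 → ℝ) ∈ convexHull ℝ
        ({![1, 1, 1], ![0, 0, 0], ![x, 0, 0], ![0, y, 0], ![x, 1, x],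
          ![1, y, y]} : Set (Fin 3 → ℝ))} =
      Set.Icc (x * y) (min x y) := by
  obtain ⟨hx0, hx1⟩ := hx
  obtain ⟨hy0, hy1⟩ := hy
  set S : Set (Fin 3 → ℝ) := {![1, 1, 1], ![0, 0, 0], ![x, 0, 0], ![0, y, 0], ![x, 1, x],
          ![1, y, y]} with hS
  have hC : Convex ℝ (convexHull ℝ S) := convex_convexHull ℝ S
  have comb : ∀ a b c a' b' c' t : ℝ, (![a, b, c] : Fin 3 → ℝ) ∈ convexHull ℝ S →
      (![a', b', c'] : Fin 3 → ℝ) ∈ convexHull ℝ S → 0 ≤ t → t ≤ 1 →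
      (![t * a + (1 - t) * a', t * b + (1 - t) * b', t * c + (1 - t) * c'] : Fin 3 → ℝ)
        ∈ convexHull ℝ S := by
    intro a b c a' b' c' t h h' h0 h1
    have := hC h h' h0 (sub_nonneg.2 h1) (by ring)
    convert this using 1
    ext i
    fin_cases i <;> simp
  have q1 : (![1, 1, 1] : Fin 3 → ℝ) ∈ convexHull ℝ S := subset_convexHull ℝ S (by simp [hS])
  have q2 : (![0, 0, 0] : Fin 3 → ℝ) ∈ convexHull ℝ S := subset_convexHull ℝ S (by simp [hS])
  have q3 : (![x, 0, 0] : Fin 3 → ℝ) ∈ convexHull ℝ S := subset_convexHull ℝ S (by simp [hS])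
  have q4 : (![0, y, 0] : Fin 3 → ℝ) ∈ convexHull ℝ S := subset_convexHull ℝ S (by simp [hS])
  have q5 : (![x, 1, x] : Fin 3 → ℝ) ∈ convexHull ℝ S := subset_convexHull ℝ S (by simp [hS])
  have low : (![x, y, x * y] : Fin 3 → ℝ) ∈ convexHull ℝ S := by
    convert comb _ _ _ _ _ _ y q5 q3 hy0 hy1 using 2
    · ring
    · congr 1
      · ring
      · congr 1
        ring
  have high : (![x, y, min x y] : Fin 3 → ℝ) ∈ convexHull ℝ S := by
    rcases le_total x y with h | h
    · rw [min_eq_left h]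
      rcases hy0.eq_or_lt with h0 | h0
      · have : x = 0 := by linarith
        rw [this, ← h0]
        exact q2
      · have := comb _ _ _ _ _ _ (x / y) (comb _ _ _ _ _ _ y q1 q2 hy0 hy1) q4
          (by positivity) ((div_le_one h0).2 h)
        convert this using 1
        ext i
        fin_cases i <;> simp <;> field_simp <;> ring
    · rw [min_eq_right h]
      rcases hx0.eq_or_lt with h0 | h0
      · have : y = 0 := by linarith
        rw [this, ← h0]
        exact q2
      · have := comb _ _ _ _ _ _ (y / x) (comb _ _ _ _ _ _ x q1 q2 hx0 hx1) q3
          (by positivity) ((div_le_one h0).2 h)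
        convert this using 1
        ext i
        fin_cases i <;> simp <;> field_simp <;> ring
  ext z
  constructor
  · intro hz
    have sub : convexHull ℝ S ⊆ {p : Fin 3 → ℝ | p 2 ≤ p 0 ∧ p 2 ≤ p 1 ∧
        y * p 0 + x * p 1 - x * y ≤ p 2} := by
      apply convexHull_min
      · intro p hp
        simp only [hS, Set.mem_insert_iff, Set.mem_singleton_iff] at hp
        rcases hp with rfl | rfl | rfl | rfl | rfl | rfl <;>
          simp <;> (try constructorm* _ ∧ _) <;> nlinarith [mul_nonneg hx0 hy0,
            mul_nonneg (sub_nonneg.2 hx1) (sub_nonneg.2 hy1)]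
      · rintro p ⟨h1, h2, h3⟩ q ⟨k1, k2, k3⟩ a b ha hb hab
        obtain rfl : b = 1 - a := by linarith
        simp only [Set.mem_setOf_eq, Pi.add_apply, Pi.smul_apply, smul_eq_mul]
        refine ⟨?_, ?_, ?_⟩
        · nlinarith
        · nlinarith
        · nlinarith [mul_le_mul_of_nonneg_left h3 ha, mul_le_mul_of_nonneg_left k3 hb]
    obtain ⟨h1, h2, h3⟩ := sub hz
    simp at h1 h2 h3
    exact ⟨by linarith, le_min h1 h2⟩
  · intro hz
    have hconv : Convex ℝ {z : ℝ | (![x, y, z] : Fin 3 → ℝ) ∈ convexHull ℝ S} := by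
      intro z hz w hw a b ha hb hab
      obtain rfl : b = 1 - a := by linarith
      have := comb _ _ _ _ _ _ a hz hw ha (by linarith)
      simp only [Set.mem_setOf_eq, smul_eq_mul]
      convert this using 1
      ext i
      fin_cases i <;> simp <;> ring
    exact hconv.ordConnected.out low high hz
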